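/- Let (S,⊔,∩) be an ado-semilattice and define a⋎b := (a⊔b)∩(b⊔a). Then for all a, b, c, d ∈ S: (1) a⊔b = a⋎(a⋎b); (2) ⋎ is commutative and idempotent; (3) (a⋎b)⊔(a⊔b) = a⊔b; (4) a⊔(b⋎c) = (a⊔b)⋎(a⊔c); and (5) if d ≲ a, d ≲ b, d ≲ c, d ≲ a⋎b and d ≲ b⋎c, then d ≲ a⋎c (where x ≲ y means y⊔x = y). -/

import Mathlib

/-- An ado-semilattice: `(S,∩)` is a meet-semilattice; with `x ≤ y` meaning
`x∩y = x`, the four o-semilattice laws hold; `⊔` is associative; and the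
distributivity law holds. -/
structure IsAdo {S : Type*} (inter ov : S → S → S) : Prop where
  inter_comm : ∀ a b, inter a b = inter b a
  inter_assoc : ∀ a b c, inter (inter a b) c = inter a (inter b c)
  inter_idem : ∀ a, inter a a = a
  le1 : ∀ x y, inter x (ov x y) = x
  le2 : ∀ x y z, inter (ov (inter x y) (inter y z)) y = ov (inter x y) (inter y z)
  le3 : ∀ x y, inter (ov x y) (ov x (inter y (ov x y))) = ov x y
  le4 : ∀ x y z, inter (inter x z) (ov (inter x y) z) = inter x z
  ov_assoc : ∀ x y z, ov (ov x y) z = ov x (ov y z)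
  distrib : ∀ a b c d,
    ov (inter a d) (inter (inter b d) (inter c d)) =
      inter (ov (inter a d) (inter b d)) (ov (inter a d) (inter c d))

namespace IsAdo

variable {S : Type*} [SemilatticeInf S] {ov : S → S → S}

variable (h : IsAdo (fun x y : S => x ⊓ y) ov)
include h

theorem left_le (x y : S) : x ≤ ov x y := inf_eq_left.1 (h.le1 x y)

theorem ov_le {x y e : S} (hx : x ≤ e) (hy : y ≤ e) : ov x y ≤ e := by
  have := h.le2 x e y
  simp only [inf_eq_left.2 hx, inf_eq_right.2 hy] at this
  exact inf_eq_left.1 this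

/-- If `u` and `v ≤ z` have a common upper bound, then `v ≤ u ⊔ z`. -/
theorem le_ov_of_bounded {u v z e : S} (hu : u ≤ e) (hv : v ≤ e) (hz : v ≤ z) :
    v ≤ ov u z := by
  have := h.le4 e u z
  simp only [inf_eq_right.2 hu] at this
  exact (le_inf hv hz).trans (inf_eq_left.1 this)

theorem right_le {x y e : S} (hx : x ≤ e) (hy : y ≤ e) : y ≤ ov x y :=
  h.le_ov_of_bounded hx hy le_rfl

theorem ov_eq_of_le {x y : S} (hxy : x ≤ y) : ov x y = y :=
  le_antisymm (h.ov_le hxy le_rfl) (h.right_le hxy le_rfl)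

theorem ov_eq_of_ge {x y : S} (hyx : y ≤ x) : ov x y = x :=
  le_antisymm (h.ov_le le_rfl hyx) (h.left_le x y)

theorem ov_comm_of_bounded {x y e : S} (hx : x ≤ e) (hy : y ≤ e) : ov x y = ov y x :=
  le_antisymm (h.ov_le (h.right_le hy hx) (h.left_le y x))
    (h.ov_le (h.right_le hx hy) (h.left_le x y))

theorem ov_inf_ov (x y : S) : ov x (y ⊓ ov x y) = ov x y :=
  le_antisymm (h.ov_le (h.left_le x y) inf_le_right) (inf_eq_left.1 (h.le3 x y))

theorem ov_inf_of_bounded {a b c d : S} (ha : a ≤ d) (hb : b ≤ d) (hc : c ≤ d) :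
    ov a (b ⊓ c) = ov a b ⊓ ov a c := by
  have := h.distrib a b c d
  simpa only [inf_eq_left.2 ha, inf_eq_left.2 hb, inf_eq_left.2 hc] using this

theorem ov_mono_right {a p q : S} (hpq : p ≤ q) : ov a p ≤ ov a q := by
  rw [← h.ov_inf_ov a p]
  exact h.ov_le (h.left_le a q)
    (h.le_ov_of_bounded (h.left_le a p) inf_le_right (inf_le_left.trans hpq))

theorem ov_inf_eq_of_le {a p r : S} (ha : a ≤ r) (hr : r ≤ ov a p) : ov a (r ⊓ p) = r := by
  have key := h.ov_inf_of_bounded (b := r) (c := p ⊓ ov a p) (h.left_le a p) hr inf_le_right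
  rw [h.ov_inf_ov, h.ov_eq_of_le ha, inf_eq_left.2 hr, inf_comm p, ← inf_assoc,
    inf_eq_left.2 hr] at key
  exact key

theorem ov_inf (a p q : S) : ov a (p ⊓ q) = ov a p ⊓ ov a q := by
  refine le_antisymm (le_inf (h.ov_mono_right inf_le_left) (h.ov_mono_right inf_le_right)) ?_
  have ha : a ≤ ov a p ⊓ ov a q := le_inf (h.left_le a p) (h.left_le a q)
  have key := h.ov_inf_of_bounded (b := (ov a p ⊓ ov a q) ⊓ p) (c := (ov a p ⊓ ov a q) ⊓ q)
    ha inf_le_left inf_le_left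
  rw [h.ov_inf_eq_of_le ha inf_le_left, h.ov_inf_eq_of_le ha inf_le_right, inf_idem] at key
  rw [← key]
  exact h.ov_mono_right (inf_le_inf inf_le_right inf_le_right)

theorem ov_ov_self (a b : S) : ov (ov a b) a = ov a b := h.ov_eq_of_ge (h.left_le a b)

theorem ov_ov_self_left (a b c : S) : ov (ov a b) (ov a c) = ov a (ov b c) := by
  rw [← h.ov_assoc, h.ov_ov_self, h.ov_assoc]

theorem ov_eq_trans {d p q : S} (hdp : ov p d = p) (hpq : ov q p = q) : ov q d = q := by
  rw [← hpq, h.ov_assoc, hdp]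

theorem le_right_of_ov_eq {x y w e : S} (hx : x ≤ e) (hy : y ≤ e) (hw : x ⊓ y ≤ w)
    (hwx : ov x w = x) (hwy : ov y w = y) : w ≤ y := by
  have hov : ov x (y ⊓ ov w y) = ov x y := by
    have h1 : ov x (ov w (y ⊓ ov w y)) = ov x (ov w y) := by rw [h.ov_inf_ov]
    rwa [← h.ov_assoc, ← h.ov_assoc, hwx] at h1
  have hle : y ≤ ov w y := by
    have h2 : ov (y ⊓ ov w y) (y ⊓ x) = ov (y ⊓ ov w y) y ⊓ ov (y ⊓ ov w y) x := h.ov_inf ..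
    rw [h.ov_eq_of_le inf_le_left, h.ov_comm_of_bounded (inf_le_left.trans hy) hx, hov,
      inf_eq_left.2 (h.right_le hx hy)] at h2
    refine h2.ge.trans (h.ov_le inf_le_right ?_)
    rw [inf_comm]
    exact hw.trans (h.left_le w y)
  rw [← hwy]
  exact h.right_le hle (h.left_le w y)

theorem inf_ov_eq {x y d e : S} (hx : x ≤ e) (hy : y ≤ e)
    (hdx : ov x d = x) (hdy : ov y d = y) : ov (x ⊓ y) d = x ⊓ y := by
  have hwx : ov x (ov (x ⊓ y) d) = x := by
    rw [← h.ov_assoc, h.ov_eq_of_ge inf_le_left, hdx]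
  have hwy : ov y (ov (x ⊓ y) d) = y := by
    rw [← h.ov_assoc, h.ov_eq_of_ge inf_le_right, hdy]
  have hw := h.left_le (x ⊓ y) d
  exact le_antisymm
    (le_inf (h.le_right_of_ov_eq hy hx (by rwa [inf_comm]) hwy hwx)
      (h.le_right_of_ov_eq hx hy hw hwx hwy)) hw

/-- If `d ≲ a`, `d ≲ b` and `d ≲ a ⋎ b`, then `d ≲ a ∩ b`. -/
theorem inf_ov_eq_of_vee {a b d : S} (ha : ov a d = a) (hb : ov b d = b)
    (hab : ov (ov a b ⊓ ov b a) d = ov a b ⊓ ov b a) : ov (a ⊓ b) d = a ⊓ b := by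
  have h1 := h.inf_ov_eq (h.left_le a b) inf_le_left ha hab
  have h2 := h.inf_ov_eq (h.left_le b a) inf_le_right hb hab
  have h3 := h.inf_ov_eq inf_le_right inf_le_right h1 h2
  exact h.ov_eq_trans h3 (h.ov_eq_of_ge (inf_le_inf inf_le_left inf_le_left))

theorem ov_vee (a b : S) : ov a (ov a b ⊓ ov b a) = ov a b := by
  rw [h.ov_inf, ← h.ov_assoc, ← h.ov_assoc, h.ov_eq_of_le le_rfl, h.ov_ov_self, inf_idem]

theorem vee_ov_eq {a b c d : S} (ha : ov a d = a) (hb : ov b d = b) (hc : ov c d = c)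
    (hab : ov (ov a b ⊓ ov b a) d = ov a b ⊓ ov b a)
    (hbc : ov (ov b c ⊓ ov c b) d = ov b c ⊓ ov c b) :
    ov (ov a c ⊓ ov c a) d = ov a c ⊓ ov c a := by
  have habc := h.inf_ov_eq (e := b) inf_le_right inf_le_left
    (h.inf_ov_eq_of_vee ha hb hab) (h.inf_ov_eq_of_vee hb hc hbc)
  refine h.ov_eq_trans habc (h.ov_eq_of_ge (le_inf ?_ ?_))
  · exact (inf_le_left.trans inf_le_left).trans (h.left_le a c)
  · exact (inf_le_right.trans inf_le_right).trans (h.left_le c a)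

end IsAdo

/-- In an ado-semilattice with `a⋎b := (a⊔b)∩(b⊔a)` and `x ≲ y`
meaning `y⊔x = y`: (1) `a⊔b = a⋎(a⋎b)`; (2) `⋎` is commutative and idempotent;
(3) `(a⋎b)⊔(a⊔b) = a⊔b`; (4) `a⊔(b⋎c) = (a⊔b)⋎(a⊔c)`; (5) `d ≲ a`, `d ≲ b`,
`d ≲ c`, `d ≲ a⋎b`, `d ≲ b⋎c` imply `d ≲ a⋎c`. -/
theorem stmt_11 {S : Type*} (inter ov : S → S → S) (h : IsAdo inter ov) :
    letI vee : S → S → S := fun a b => inter (ov a b) (ov b a)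
    (∀ a b, ov a b = vee a (vee a b)) ∧
    (∀ a b, vee a b = vee b a) ∧
    (∀ a, vee a a = a) ∧
    (∀ a b, ov (vee a b) (ov a b) = ov a b) ∧
    (∀ a b c, ov a (vee b c) = vee (ov a b) (ov a c)) ∧
    (∀ a b c d, ov a d = a → ov b d = b → ov c d = c →
      ov (vee a b) d = vee a b → ov (vee b c) d = vee b c →
      ov (vee a c) d = vee a c) := by
  let : SemilatticeInf S :=
    { inf := inter
      le := fun a b => inter a b = a
      le_refl := h.inter_idem
      le_trans := fun a b c hab hbc => by
        rw [← hab, h.inter_assoc, hbc]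
      le_antisymm := fun a b hab hba => by
        rw [← hab, h.inter_comm, hba]
      inf_le_left := fun a b => by
        rw [h.inter_comm, ← h.inter_assoc, h.inter_idem]
      inf_le_right := fun a b => by
        rw [h.inter_assoc, h.inter_idem]
      le_inf := fun a b c hab hac => by
        rw [← h.inter_assoc, hab, hac] }
  have h' : IsAdo (fun x y : S => x ⊓ y) ov := h
  refine ⟨fun a b => ?_, fun a b => h.inter_comm _ _, fun a => ?_, fun a b => ?_,
    fun a b c => ?_, fun a b c d => h'.vee_ov_eq⟩
  · change ov a b = ov a (ov a b ⊓ ov b a) ⊓ ov (ov a b ⊓ ov b a) a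
    rw [h'.ov_comm_of_bounded (x := ov a b ⊓ ov b a) inf_le_left (h'.left_le a b), h'.ov_vee,
      inf_idem]
  · change ov a a ⊓ ov a a = a
    rw [inf_idem, h'.ov_eq_of_le le_rfl]
  · exact h'.ov_eq_of_le inf_le_left
  · change ov a (ov b c ⊓ ov c b) = ov (ov a b) (ov a c) ⊓ ov (ov a c) (ov a b)
    rw [h'.ov_inf, h'.ov_ov_self_left, h'.ov_ov_self_left]
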